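/- Let (Z,ρ₀) be an antipodal space and ρ ∈ M(Z). Then the tangent space T_ρM(Z), defined as the set of all v ∈ C(Z) for which there exist ε > 0 and a curve t ∈ (−ε,ε) ↦ ρ(t) ∈ M(Z) with ρ(0) = ρ such that ‖(1/t)·log(dρ(t)/dρ) − v‖_∞ → 0 as t → 0, is equal to the set O_ρ(Z) of ρ-odd functions, where v ∈ C(Z) is ρ-odd if v(ξ) + v(η) = 0 whenever ξ, η ∈ Z satisfy ρ(ξ,η) = 1. In particular T_ρM(Z) is a closed linear subspace of C(Z). -/

import Mathlib

open Filter Topology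
open scoped Classical

variable {Z : Type*}

/-- `Z` has at least four points. -/
def HasFourPoints (Z : Type*) : Prop :=
  ∃ a b c d : Z, a ≠ b ∧ a ≠ c ∧ a ≠ d ∧ b ≠ c ∧ b ≠ d ∧ c ≠ d

/-- A separating function on `Z`: continuous, symmetric, and positive. -/
structure IsSeparating [TopologicalSpace Z] (ρ : Z → Z → ℝ) : Prop where
  continuous : Continuous fun p : Z × Z => ρ p.1 p.2
  symm : ∀ ξ η, ρ ξ η = ρ η ξ
  nonneg : ∀ ξ η, 0 ≤ ρ ξ η
  eq_zero_iff : ∀ ξ η, ρ ξ η = 0 ↔ ξ = η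

/-- The cross-ratio of a quadruple of points with respect to `ρ`. -/
noncomputable def crossRatio (ρ : Z → Z → ℝ) (ξ ξ' η η' : Z) : ℝ :=
  ρ ξ η * ρ ξ' η' / (ρ ξ η' * ρ ξ' η)

/-- Two functions are Moebius equivalent if their cross-ratios agree on all quadruples
of pairwise distinct points. -/
def MoebiusEquiv (ρ₁ ρ₂ : Z → Z → ℝ) : Prop :=
  ∀ ξ ξ' η η' : Z, ξ ≠ ξ' → ξ ≠ η → ξ ≠ η' → ξ' ≠ η → ξ' ≠ η' → η ≠ η' →
    crossRatio ρ₁ ξ ξ' η η' = crossRatio ρ₂ ξ ξ' η η'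

/-- An antipodal function on `Z`: a separating function with values in `[0,1]` such that
every point has an antipode. -/
structure IsAntipodal [TopologicalSpace Z] (ρ : Z → Z → ℝ) : Prop where
  toIsSeparating : IsSeparating ρ
  le_one : ∀ ξ η, ρ ξ η ≤ 1
  antipode : ∀ ξ, ∃ η, ρ ξ η = 1

/-- The Moebius space `M(Z, ρ₀)`: antipodal functions Moebius equivalent to `ρ₀`. -/
def MoebiusSpace [TopologicalSpace Z] (ρ₀ : Z → Z → ℝ) : Set (Z → Z → ℝ) :=
  {ρ | IsAntipodal ρ ∧ MoebiusEquiv ρ₀ ρ}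

/-- The derivative `dρ₂/dρ₁`: the (unique, when it exists) positive continuous function
satisfying the geometric mean value theorem
`ρ₂(ξ,η)² = f(ξ) f(η) ρ₁(ξ,η)²`. -/
noncomputable def mDeriv [TopologicalSpace Z] (ρ₁ ρ₂ : Z → Z → ℝ) : Z → ℝ :=
  if h : ∃ f : Z → ℝ, Continuous f ∧ (∀ ξ, 0 < f ξ) ∧
      ∀ ξ η, ρ₂ ξ η ^ 2 = f ξ * f η * ρ₁ ξ η ^ 2
  then h.choose else fun _ => 1

/-- The metric `d_M(ρ₁, ρ₂) = ‖log (dρ₂/dρ₁)‖_∞` on the Moebius space. -/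
noncomputable def dM [TopologicalSpace Z] (ρ₁ ρ₂ : Z → Z → ℝ) : ℝ :=
  ⨆ ξ : Z, |Real.log (mDeriv ρ₁ ρ₂ ξ)|

/-- The discrepancy function `D_{ρ₁}(τ)(ξ) = max_{η ≠ ξ} (τ(ξ) + τ(η) + log ρ₁(ξ,η)²)`. -/
noncomputable def discrepancy [TopologicalSpace Z] (ρ₁ : Z → Z → ℝ) (τ : C(Z, ℝ))
    (ξ : Z) : ℝ :=
  ⨆ η : {η : Z // η ≠ ξ}, (τ ξ + τ η.1 + Real.log (ρ₁ ξ η.1 ^ 2))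

/-- `E_{ρ₁}(τ)(ξ,η) = e^{τ(ξ)/2} e^{τ(η)/2} ρ₁(ξ,η)`. -/
noncomputable def eMap [TopologicalSpace Z] (ρ₁ : Z → Z → ℝ) (τ : C(Z, ℝ)) :
    Z → Z → ℝ :=
  fun ξ η => Real.exp (τ ξ / 2) * Real.exp (τ η / 2) * ρ₁ ξ η

/-- A solution of the `ρ₁`-antipodal flow `dτ_t/dt = -D_{ρ₁}(τ_t)` on `[0, ∞)`. -/
def IsAntipodalFlowSol [TopologicalSpace Z] [CompactSpace Z]
    (ρ₁ : Z → Z → ℝ) (τ : ℝ → C(Z, ℝ)) : Prop :=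
  ∀ t ∈ Set.Ici (0 : ℝ), ∃ τ' : C(Z, ℝ),
    (∀ ξ, τ' ξ = -discrepancy ρ₁ (τ t) ξ) ∧
    HasDerivWithinAt τ τ' (Set.Ici (0 : ℝ)) t

/-- The antipodalization map `P_∞(τ₀, ρ₁) = E_{ρ₁}(τ_∞)`, where `τ_∞` is the limit as
`t → ∞` of the solution of the `ρ₁`-antipodal flow starting at `τ₀`. -/
noncomputable def antipodalization [TopologicalSpace Z] [CompactSpace Z]
    (ρ₁ : Z → Z → ℝ) (τ₀ : C(Z, ℝ)) : Z → Z → ℝ :=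
  if h : ∃ p : (ℝ → C(Z, ℝ)) × C(Z, ℝ), p.1 0 = τ₀ ∧ IsAntipodalFlowSol ρ₁ p.1 ∧
      Filter.Tendsto p.1 Filter.atTop (𝓝 p.2)
  then eMap ρ₁ h.choose.2 else ρ₁


/-- The tangent set `T_ρ M(Z)`: derivatives at `t = 0` of admissible curves at `ρ`. -/
noncomputable def tangentSet [TopologicalSpace Z] [CompactSpace Z]
    (ρ₀ ρ : Z → Z → ℝ) : Set (C(Z, ℝ)) :=
  {v | ∃ ε > (0 : ℝ), ∃ c : ℝ → Z → Z → ℝ,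
    (∀ t ∈ Set.Ioo (-ε) ε, c t ∈ MoebiusSpace ρ₀) ∧ c 0 = ρ ∧
    Tendsto (fun t : ℝ => ⨆ ξ : Z, |(1 / t) * Real.log (mDeriv ρ (c t) ξ) - v ξ|)
      (𝓝[≠] (0 : ℝ)) (𝓝 0)}

/-- The set of `ρ`-odd functions. -/
def oddSet [TopologicalSpace Z] (ρ : Z → Z → ℝ) : Set (C(Z, ℝ)) :=
  {v | ∀ ξ η : Z, ρ ξ η = 1 → v ξ + v η = 0}

theorem mDeriv_continuous [TopologicalSpace Z] (ρ₁ ρ₂ : Z → Z → ℝ) :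
    Continuous (mDeriv ρ₁ ρ₂) := by
  unfold mDeriv
  split_ifs with h
  · exact h.choose_spec.1
  · exact continuous_const

theorem mDeriv_pos [TopologicalSpace Z] (ρ₁ ρ₂ : Z → Z → ℝ) (ξ : Z) :
    0 < mDeriv ρ₁ ρ₂ ξ := by
  unfold mDeriv
  split_ifs with h
  · exact h.choose_spec.2.1 ξ
  · exact one_pos

/-- At a pair of `ρ₁`-antipodal points, the product of the derivatives is at most one. -/
theorem mDeriv_mul_le_one [TopologicalSpace Z] {ρ₁ ρ₂ : Z → Z → ℝ} (h₂ : IsAntipodal ρ₂)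
    {ξ η : Z} (h : ρ₁ ξ η = 1) : mDeriv ρ₁ ρ₂ ξ * mDeriv ρ₁ ρ₂ η ≤ 1 := by
  unfold mDeriv
  split_ifs with hf
  · have := hf.choose_spec.2.2 ξ η
    rw [h, one_pow, mul_one] at this
    rw [← this]
    exact pow_le_one₀ (h₂.toIsSeparating.nonneg _ _) (h₂.le_one _ _)
  · simp

theorem HasFourPoints.exists_two_ne (h4 : HasFourPoints Z) (x : Z) :
    ∃ y z : Z, x ≠ y ∧ x ≠ z ∧ y ≠ z := by
  obtain ⟨a, b, c, d, hab, hac, had, hbc, hbd, hcd⟩ := h4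
  by_cases hxa : x = a
  · exact ⟨b, c, hxa ▸ hab, hxa ▸ hac, hbc⟩
  by_cases hxb : x = b
  · exact ⟨a, c, hxa, hxb ▸ hbc, hac⟩
  exact ⟨a, b, hxa, hxb, hab⟩

/-- Uniqueness of the derivative. -/
theorem mDeriv_eq [TopologicalSpace Z] (h4 : HasFourPoints Z) {ρ₁ ρ₂ : Z → Z → ℝ}
    (h₁ : IsSeparating ρ₁) {f : Z → ℝ} (hf : Continuous f) (hpos : ∀ ξ, 0 < f ξ)
    (h : ∀ ξ η, ρ₂ ξ η ^ 2 = f ξ * f η * ρ₁ ξ η ^ 2) : mDeriv ρ₁ ρ₂ = f := by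
  have hex : ∃ f : Z → ℝ, Continuous f ∧ (∀ ξ, 0 < f ξ) ∧
      ∀ ξ η, ρ₂ ξ η ^ 2 = f ξ * f η * ρ₁ ξ η ^ 2 := ⟨f, hf, hpos, h⟩
  have hg : ∀ ξ η, ρ₂ ξ η ^ 2 = mDeriv ρ₁ ρ₂ ξ * mDeriv ρ₁ ρ₂ η * ρ₁ ξ η ^ 2 := by
    unfold mDeriv
    rw [dif_pos hex]
    exact hex.choose_spec.2.2
  have gpos := mDeriv_pos ρ₁ ρ₂
  generalize mDeriv ρ₁ ρ₂ = g at hg gpos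
  have key : ∀ ξ η, ξ ≠ η → g ξ * g η = f ξ * f η := fun ξ η hne => by
    have h0 : ρ₁ ξ η ^ 2 ≠ 0 := pow_ne_zero _ (mt (h₁.eq_zero_iff ξ η).1 hne)
    exact mul_right_cancel₀ h0 ((hg ξ η).symm.trans (h ξ η))
  funext x
  obtain ⟨y, z, hxy, hxz, hyz⟩ := h4.exists_two_ne x
  have hsq : g x ^ 2 * (g y * g z) = f x ^ 2 * (g y * g z) := by
    calc g x ^ 2 * (g y * g z) = (g x * g y) * (g x * g z) := by ring
      _ = f x ^ 2 * (f y * f z) := by rw [key x y hxy, key x z hxz]; ring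
      _ = f x ^ 2 * (g y * g z) := by rw [key y z hyz]
  have := mul_right_cancel₀ (mul_pos (gpos y) (gpos z)).ne' hsq
  exact (pow_left_inj₀ (gpos x).le (hpos x).le two_ne_zero).1 this

theorem tangentSet_subset_oddSet [TopologicalSpace Z] [CompactSpace Z] (ρ₀ ρ : Z → Z → ℝ) :
    tangentSet ρ₀ ρ ⊆ oddSet ρ := by
  rintro v ⟨ε, hε, c, hc, -, hlim⟩ ξ η hξη
  have pt : ∀ x : Z, Tendsto (fun t : ℝ => (1 / t) * Real.log (mDeriv ρ (c t) x))
      (𝓝[≠] (0 : ℝ)) (𝓝 (v x)) := fun x => by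
    rw [tendsto_iff_dist_tendsto_zero]
    refine squeeze_zero (fun _ => dist_nonneg) (fun t => ?_) hlim
    have hcont : Continuous fun x : Z => |(1 / t) * Real.log (mDeriv ρ (c t) x) - v x| :=
      ((continuous_const.mul ((mDeriv_continuous ρ (c t)).log
        fun x => (mDeriv_pos ρ (c t) x).ne')).sub v.continuous).abs
    exact le_ciSup (f := fun x : Z => |(1 / t) * Real.log (mDeriv ρ (c t) x) - v x|)
      (isCompact_range hcont).bddAbove x
  have hsum := (pt ξ).add (pt η)
  have hle : ∀ᶠ t in 𝓝 (0 : ℝ),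
      Real.log (mDeriv ρ (c t) ξ) + Real.log (mDeriv ρ (c t) η) ≤ 0 := by
    filter_upwards [Ioo_mem_nhds (neg_lt_zero.2 hε) hε] with t ht
    rw [← Real.log_mul (mDeriv_pos _ _ _).ne' (mDeriv_pos _ _ _).ne']
    exact Real.log_nonpos (mul_pos (mDeriv_pos _ _ _) (mDeriv_pos _ _ _)).le
      (mDeriv_mul_le_one (hc t ht).1 hξη)
  apply le_antisymm
  · refine le_of_tendsto (hsum.mono_left (nhdsGT_le_nhdsNE 0)) ?_
    filter_upwards [hle.filter_mono nhdsWithin_le_nhds, self_mem_nhdsWithin] with t ht h0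
    rw [← mul_add]
    exact mul_nonpos_of_nonneg_of_nonpos (one_div_nonneg.2 (le_of_lt h0)) ht
  · refine ge_of_tendsto (hsum.mono_left (nhdsLT_le_nhdsNE 0)) ?_
    filter_upwards [hle.filter_mono nhdsWithin_le_nhds, self_mem_nhdsWithin] with t ht h0
    rw [← mul_add]
    exact mul_nonneg_of_nonpos_of_nonpos (one_div_nonpos.2 (le_of_lt h0)) ht

/-- A maximal positive function `F ≥ F₀` subject to `F ξ * F η * ρ ξ η ≤ 1`. -/
theorem exists_maximal_scaling [TopologicalSpace Z] {ρ : Z → Z → ℝ} (hρ : IsAntipodal ρ)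
    {F₀ : Z → ℝ} (hpos : ∀ ξ, 0 < F₀ ξ) (hF₀ : ∀ ξ η, F₀ ξ * F₀ η * ρ ξ η ≤ 1) :
    ∃ F : Z → ℝ, F₀ ≤ F ∧ (∀ ξ η, F ξ * F η * ρ ξ η ≤ 1) ∧
      ∀ ξ, ∀ r < 1, ∃ η, r < F ξ * F η * ρ ξ η := by
  have hnn := hρ.toIsSeparating.nonneg
  set S : Set (Z → ℝ) := {F | F₀ ≤ F ∧ ∀ ξ η, F ξ * F η * ρ ξ η ≤ 1} with hS
  have hbd : ∀ ξ, ∃ B, ∀ F ∈ S, F ξ ≤ B := fun ξ => by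
    obtain ⟨η, hη⟩ := hρ.antipode ξ
    refine ⟨1 / F₀ η, fun F hF => ?_⟩
    rw [le_div_iff₀ (hpos η)]
    have h1 := hF.2 ξ η
    rw [hη, mul_one] at h1
    exact (mul_le_mul_of_nonneg_left (hF.1 η) ((hpos ξ).le.trans (hF.1 ξ))).trans h1
  obtain ⟨F, hF₀F, hmax⟩ := zorn_le_nonempty₀ S (fun C hCS hC G hG => by
    have hbdd : ∀ ξ, BddAbove (Set.range fun H : C => H.1 ξ) := fun ξ => by
      obtain ⟨B, hB⟩ := hbd ξ
      exact ⟨B, by rintro _ ⟨H, rfl⟩; exact hB _ (hCS H.2)⟩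
    have : Nonempty C := ⟨⟨G, hG⟩⟩
    have hle : ∀ H ∈ C, H ≤ fun ξ => ⨆ H : C, H.1 ξ := fun H hH ξ =>
      le_ciSup (hbdd ξ) (⟨H, hH⟩ : C)
    refine ⟨fun ξ => ⨆ H : C, H.1 ξ, ⟨(hCS hG).1.trans (hle G hG), fun ξ η => ?_⟩, hle⟩
    by_cases h0 : ρ ξ η = 0
    · simp [h0]
    have hp : 0 < ρ ξ η := lt_of_le_of_ne (hnn ξ η) (Ne.symm h0)
    have hGpos : ∀ x, ∀ H ∈ C, 0 < H x := fun x H hH => (hpos x).trans_le ((hCS hH).1 x)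
    have hsp : ∀ x, 0 < ⨆ H : C, H.1 x := fun x => (hGpos x G hG).trans_le (hle G hG x)
    have h1 : ∀ H₁ ∈ C, ∀ H₂ ∈ C, H₁ ξ * H₂ η * ρ ξ η ≤ 1 := fun H₁ m₁ H₂ m₂ => by
      rcases hC.total m₁ m₂ with h | h
      · refine le_trans ?_ ((hCS m₂).2 ξ η)
        have := (hGpos η H₂ m₂).le
        gcongr
        exact h ξ
      · refine le_trans ?_ ((hCS m₁).2 ξ η)
        have := (hGpos ξ H₁ m₁).le
        gcongr
        exact h η
    have h2 : ∀ H₁ ∈ C, (⨆ H : C, H.1 η) ≤ 1 / (H₁ ξ * ρ ξ η) := fun H₁ m₁ =>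
      ciSup_le fun H => by
        rw [le_div_iff₀ (mul_pos (hGpos ξ H₁ m₁) hp)]
        linarith [h1 H₁ m₁ H.1 H.2]
    have h3 : (⨆ H : C, H.1 ξ) ≤ 1 / ((⨆ H : C, H.1 η) * ρ ξ η) :=
      ciSup_le fun H => by
        rw [le_div_iff₀ (mul_pos (hsp η) hp)]
        have := (le_div_iff₀ (mul_pos (hGpos ξ H.1 H.2) hp)).1 (h2 H.1 H.2)
        linarith
    have := (le_div_iff₀ (mul_pos (hsp η) hp)).1 h3
    linarith) F₀ ⟨le_rfl, hF₀⟩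
  refine ⟨F, hF₀F, hmax.prop.2, fun ξ r hr => ?_⟩
  by_contra! hcon
  have hFpos : ∀ x, 0 < F x := fun x => (hpos x).trans_le (hF₀F x)
  set s := max r (1 / 2) with hs
  have hs1 : s < 1 := max_lt hr (by norm_num)
  have hs0 : 0 < s := lt_of_lt_of_le (by norm_num) (le_max_right _ _)
  have hlt : F ξ < F ξ / s := by
    rw [lt_div_iff₀ hs0]
    nlinarith [hFpos ξ]
  have hup : F ≤ Function.update F ξ (F ξ / s) := le_update_iff.2 ⟨hlt.le, fun _ _ => le_rfl⟩
  have hone : ∀ η, F ξ / s * F η * ρ ξ η ≤ 1 := fun η => by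
    have : F ξ / s * F η * ρ ξ η = F ξ * F η * ρ ξ η / s := by ring
    rw [this, div_le_one hs0]
    exact (hcon η).trans (le_max_left _ _)
  have hmem : Function.update F ξ (F ξ / s) ∈ S := by
    refine ⟨hF₀F.trans hup, fun x y => ?_⟩
    by_cases hx : x = ξ
    · subst hx
      by_cases hy : y = x
      · subst hy
        rw [(hρ.toIsSeparating.eq_zero_iff y y).2 rfl, mul_zero]
        exact zero_le_one
      · rw [Function.update_self, Function.update_of_ne hy]
        exact hone y
    · by_cases hy : y = ξ
      · subst hy
        rw [Function.update_self, Function.update_of_ne hx, hρ.toIsSeparating.symm x y,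
          mul_comm (F x)]
        exact hone x
      · rw [Function.update_of_ne hx, Function.update_of_ne hy]
        exact hmax.prop.2 x y
  have := hmax.le_of_ge hmem hup ξ
  rw [Function.update_self] at this
  exact absurd hlt (not_lt.2 this)

/-- A bounded positive function satisfying the conclusion of `exists_maximal_scaling`
is continuous. -/
theorem continuous_of_maximal_scaling [TopologicalSpace Z] [CompactSpace Z] {ρ : Z → Z → ℝ}
    (hρ : IsSeparating ρ) {F : Z → ℝ} {B : ℝ} (hpos : ∀ ξ, 0 < F ξ) (hB : ∀ ξ, F ξ ≤ B)
    (hle : ∀ ξ η, F ξ * F η * ρ ξ η ≤ 1)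
    (hsup : ∀ ξ, ∀ r < 1, ∃ η, r < F ξ * F η * ρ ξ η) : Continuous F := by
  let P : C(Z, C(Z, ℝ)) := ContinuousMap.curry ⟨fun p : Z × Z => ρ p.1 p.2, hρ.continuous⟩
  have hP : ∀ ξ η, P ξ η = ρ ξ η := fun _ _ => rfl
  have hone : ∀ x y, (F x)⁻¹ - (F y)⁻¹ ≤ B * dist (P x) (P y) := fun x y => by
    refine le_of_forall_pos_le_add fun e he => ?_
    have hBpos : 0 < B := (hpos x).trans_le (hB x)
    obtain ⟨η, hη⟩ := hsup x (1 - e * F x) (by nlinarith [hpos x])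
    have h1 : (F x)⁻¹ - e < F η * ρ x η := by
      have h2 : F x * ((F x)⁻¹ - e) < F x * (F η * ρ x η) := by
        rw [mul_sub, mul_inv_cancel₀ (hpos x).ne']
        linarith
      exact lt_of_mul_lt_mul_left h2 (hpos x).le
    have h3 : F η * ρ y η ≤ (F y)⁻¹ := by
      rw [← one_div, le_div_iff₀ (hpos y)]
      linarith [hle y η]
    have h4 : ρ x η - ρ y η ≤ dist (P x) (P y) :=
      (le_abs_self _).trans (ContinuousMap.dist_apply_le_dist (f := P x) (g := P y) η)
    have h5 : F η * (ρ x η - ρ y η) ≤ B * dist (P x) (P y) :=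
      (mul_le_mul_of_nonneg_left h4 (hpos η).le).trans
        (mul_le_mul_of_nonneg_right (hB η) dist_nonneg)
    linarith
  have hinv : Continuous fun x => (F x)⁻¹ := by
    rw [continuous_iff_continuousAt]
    intro x
    rw [ContinuousAt, tendsto_iff_dist_tendsto_zero]
    have hlim : Tendsto (fun y => B * dist (P y) (P x)) (𝓝 x) (𝓝 0) := by
      have : Continuous fun y => B * dist (P y) (P x) := by fun_prop
      simpa using this.tendsto x
    refine squeeze_zero (fun _ => dist_nonneg) (fun y => ?_) hlim
    rw [Real.dist_eq, abs_le]
    have := hone x y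
    rw [dist_comm (P x)] at this
    exact ⟨by linarith, hone y x⟩
  have := hinv.inv₀ fun x => inv_ne_zero (hpos x).ne'
  simpa only [Pi.inv_def, inv_inv] using this

/-- Rescaling an antipodal function by a continuous function that saturates the bound
`F ξ * F η * ρ ξ η ≤ 1` at every point stays in the Moebius space. -/
theorem scaling_mem_moebiusSpace [TopologicalSpace Z] [CompactSpace Z] {ρ₀ ρ : Z → Z → ℝ}
    (hρ : ρ ∈ MoebiusSpace ρ₀) {F : Z → ℝ} (hF : Continuous F) (hpos : ∀ ξ, 0 < F ξ)
    (hle : ∀ ξ η, F ξ * F η * ρ ξ η ≤ 1)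
    (hsup : ∀ ξ, ∀ r < 1, ∃ η, r < F ξ * F η * ρ ξ η) :
    (fun ξ η => F ξ * F η * ρ ξ η) ∈ MoebiusSpace ρ₀ := by
  obtain ⟨hA, hM⟩ := hρ
  have hS := hA.toIsSeparating
  have hcont : Continuous fun p : Z × Z => F p.1 * F p.2 * ρ p.1 p.2 :=
    ((hF.comp continuous_fst).mul (hF.comp continuous_snd)).mul hS.continuous
  refine ⟨⟨⟨hcont, fun ξ η => ?_, fun ξ η => ?_, fun ξ η => ?_⟩, hle, fun ξ => ?_⟩, ?_⟩
  · rw [hS.symm ξ η, mul_comm (F ξ)]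
  · exact mul_nonneg (mul_pos (hpos _) (hpos _)).le (hS.nonneg _ _)
  · rw [mul_eq_zero, hS.eq_zero_iff]
    exact or_iff_right (mul_pos (hpos _) (hpos _)).ne'
  · have hc : Continuous fun η => F ξ * F η * ρ ξ η :=
      hcont.comp (Continuous.prodMk_right ξ)
    obtain ⟨η, -, hη⟩ := isCompact_univ.exists_isMaxOn ⟨ξ, Set.mem_univ ξ⟩ hc.continuousOn
    refine ⟨η, le_antisymm (hle ξ η) (le_of_not_gt fun hlt => ?_)⟩
    obtain ⟨η', hη'⟩ := hsup ξ _ hlt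
    exact absurd hη' (not_lt.2 (hη (Set.mem_univ η')))
  · intro ξ ξ' η η' h1 h2 h3 h4 h5 h6
    rw [hM ξ ξ' η η' h1 h2 h3 h4 h5 h6]
    have hne : F ξ * F ξ' * F η * F η' ≠ 0 :=
      (mul_pos (mul_pos (mul_pos (hpos _) (hpos _)) (hpos _)) (hpos _)).ne'
    unfold crossRatio
    rw [← mul_div_mul_left _ _ hne]
    congr 1 <;> ring

/-- If `v` is `ρ`-odd, then `ρ` scaled by `exp (t v / 2)` exceeds one by at most
`o(t)` on the logarithmic scale. -/
theorem eventually_exp_mul_le [TopologicalSpace Z] [CompactSpace Z] {ρ : Z → Z → ℝ}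
    (hρ : IsAntipodal ρ) {v : C(Z, ℝ)} (hv : v ∈ oddSet ρ) {e : ℝ} (he : 0 < e) :
    ∀ᶠ t in 𝓝 (0 : ℝ), ∀ ξ η,
      Real.exp (t * (v ξ + v η) / 2) * ρ ξ η ≤ Real.exp (e * |t|) := by
  have hS := hρ.toIsSeparating
  have hsumc : Continuous fun p : Z × Z => |v p.1 + v p.2| := by fun_prop
  set K : Set (Z × Z) := {p | 2 * e ≤ |v p.1 + v p.2|}
  have hKc : IsCompact K := (isClosed_le continuous_const hsumc).isCompact
  obtain ⟨m, hm0, hm1, hm⟩ : ∃ m : ℝ, 0 ≤ m ∧ m < 1 ∧ ∀ p ∈ K, ρ p.1 p.2 ≤ m := by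
    rcases K.eq_empty_or_nonempty with h | h
    · exact ⟨0, le_rfl, one_pos, by simp [h]⟩
    · obtain ⟨p, hpK, hp⟩ := hKc.exists_isMaxOn h hS.continuous.continuousOn
      refine ⟨ρ p.1 p.2, hS.nonneg _ _, lt_of_le_of_ne (hρ.le_one _ _) fun h1 => ?_,
        fun q hq => hp hq⟩
      have : 2 * e ≤ |v p.1 + v p.2| := hpK
      rw [hv _ _ h1, abs_zero] at this
      linarith
  have hlim : Tendsto (fun t : ℝ => Real.exp (|t| * ‖v‖) * m) (𝓝 0) (𝓝 m) := by
    have : Continuous fun t : ℝ => Real.exp (|t| * ‖v‖) * m := by fun_prop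
    simpa using this.tendsto 0
  filter_upwards [hlim.eventually (gt_mem_nhds hm1)] with t ht ξ η
  by_cases hp : (ξ, η) ∈ K
  · have hsum : |v ξ + v η| ≤ 2 * ‖v‖ := by
      have h1 := v.norm_coe_le_norm ξ
      have h2 := v.norm_coe_le_norm η
      rw [Real.norm_eq_abs] at h1 h2
      linarith [abs_add_le (v ξ) (v η)]
    have hexp : t * (v ξ + v η) / 2 ≤ |t| * ‖v‖ := by
      have h1 := le_abs_self (t * (v ξ + v η))
      rw [abs_mul] at h1
      have h2 := mul_le_mul_of_nonneg_left hsum (abs_nonneg t)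
      linarith
    calc Real.exp (t * (v ξ + v η) / 2) * ρ ξ η ≤ Real.exp (|t| * ‖v‖) * m :=
          mul_le_mul (Real.exp_le_exp.2 hexp) (hm _ hp) (hS.nonneg _ _) (Real.exp_pos _).le
      _ ≤ 1 := ht.le
      _ ≤ Real.exp (e * |t|) := Real.one_le_exp (by positivity)
  · have hsum : |v ξ + v η| ≤ 2 * e := (not_le.1 hp).le
    have hexp : t * (v ξ + v η) / 2 ≤ e * |t| := by
      have h1 := le_abs_self (t * (v ξ + v η))
      rw [abs_mul] at h1
      have h2 := mul_le_mul_of_nonneg_left hsum (abs_nonneg t)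
      linarith
    exact (mul_le_of_le_one_right (Real.exp_pos _).le (hρ.le_one _ _)).trans
      (Real.exp_le_exp.2 hexp)

/-- If `w` is `ρ`-odd and `exp ((w ξ + w η) / 2) * ρ ξ η ≤ exp δ`, then some element of the
Moebius space has logarithmic derivative within `δ` of `w`. -/
theorem exists_mem_moebiusSpace_near [TopologicalSpace Z] [CompactSpace Z]
    (h4 : HasFourPoints Z) {ρ₀ ρ : Z → Z → ℝ} (hρ : ρ ∈ MoebiusSpace ρ₀) {w : C(Z, ℝ)}
    (hw : w ∈ oddSet ρ) {δ : ℝ}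
    (hδ : ∀ ξ η, Real.exp ((w ξ + w η) / 2) * ρ ξ η ≤ Real.exp δ) :
    ∃ σ ∈ MoebiusSpace ρ₀, ∀ ξ, |Real.log (mDeriv ρ σ ξ) - w ξ| ≤ δ := by
  have hA := hρ.1
  have h0pos : ∀ ξ, 0 < Real.exp ((w ξ - δ) / 2) := fun ξ => Real.exp_pos _
  obtain ⟨F, hF₀, hle, hsup⟩ := exists_maximal_scaling hA
    (F₀ := fun ξ => Real.exp ((w ξ - δ) / 2)) h0pos (fun ξ η => by
      have : Real.exp ((w ξ - δ) / 2) * Real.exp ((w η - δ) / 2) * ρ ξ η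
          = Real.exp ((w ξ + w η) / 2) * ρ ξ η * Real.exp (-δ) := by
        rw [← Real.exp_add, mul_right_comm, ← Real.exp_add]
        ring_nf
      rw [this]
      calc _ ≤ Real.exp δ * Real.exp (-δ) :=
            mul_le_mul_of_nonneg_right (hδ ξ η) (Real.exp_pos _).le
        _ = 1 := by rw [← Real.exp_add, add_neg_cancel, Real.exp_zero])
  have hpos : ∀ ξ, 0 < F ξ := fun ξ => (h0pos ξ).trans_le (hF₀ ξ)
  have hub : ∀ ξ, F ξ ≤ Real.exp ((w ξ + δ) / 2) := fun ξ => by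
    obtain ⟨η, hη⟩ := hA.antipode ξ
    have h1 := hle ξ η
    rw [hη, mul_one] at h1
    have hwη : w η = -w ξ := by linarith [hw ξ η hη]
    have h2 : F ξ * Real.exp ((w η - δ) / 2) ≤ 1 :=
      (mul_le_mul_of_nonneg_left (hF₀ η) (hpos ξ).le).trans h1
    rw [← le_div_iff₀ (Real.exp_pos _), one_div, ← Real.exp_neg, hwη] at h2
    refine h2.trans_eq ?_
    ring_nf
  have hcont : Continuous F := by
    refine continuous_of_maximal_scaling hA.toIsSeparating (B := Real.exp ((‖w‖ + δ) / 2)) hpos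
      (fun ξ => (hub ξ).trans (Real.exp_le_exp.2 ?_)) hle hsup
    linarith [(le_abs_self _).trans (w.norm_coe_le_norm ξ)]
  refine ⟨_, scaling_mem_moebiusSpace hρ hcont hpos hle hsup, fun ξ => ?_⟩
  rw [mDeriv_eq h4 hA.toIsSeparating (f := fun ξ => F ξ ^ 2) (hcont.pow 2) (fun ξ => pow_pos (hpos ξ) 2)
    (fun ξ η => by ring), Real.log_pow, abs_le]
  have h1 := Real.log_le_log (h0pos ξ) (hF₀ ξ)
  have h2 := Real.log_le_log (hpos ξ) (hub ξ)
  rw [Real.log_exp] at h1 h2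
  push_cast
  constructor <;> linarith

theorem oddSet_subset_tangentSet [TopologicalSpace Z] [CompactSpace Z]
    (h4 : HasFourPoints Z) {ρ₀ ρ : Z → Z → ℝ} (hρ : ρ ∈ MoebiusSpace ρ₀) :
    oddSet ρ ⊆ tangentSet ρ₀ ρ := by
  intro v hv
  have hA := hρ.1
  let G : ℝ → C(Z × Z, ℝ) := fun t =>
    ⟨fun p => Real.exp (t * (v p.1 + v p.2) / 2) * ρ p.1 p.2,
      Continuous.mul (by fun_prop) hA.toIsSeparating.continuous⟩
  have ⟨z, _⟩ := h4
  obtain ⟨z', hz'⟩ := hA.antipode z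
  have hGz : ∀ t, G t (z, z') = 1 := fun t => by
    change Real.exp (t * (v z + v z') / 2) * ρ z z' = 1
    rw [hv z z' hz', hz']
    simp
  have hG1 : ∀ t, 0 < ‖G t‖ := fun t => by
    have := (G t).norm_coe_le_norm (z, z')
    rw [hGz, norm_one] at this
    linarith
  have hcurve : ∀ t : ℝ, ∃ σ ∈ MoebiusSpace ρ₀,
      ∀ ξ, |Real.log (mDeriv ρ σ ξ) - t * v ξ| ≤ Real.log ‖G t‖ := fun t => by
    refine exists_mem_moebiusSpace_near h4 hρ (w := t • v) (fun ξ η h => ?_) (fun ξ η => ?_)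
    · simp only [ContinuousMap.smul_apply, smul_eq_mul]
      rw [← mul_add, hv ξ η h, mul_zero]
    · rw [Real.exp_log (hG1 t)]
      refine le_trans (le_of_eq ?_) ((le_abs_self _).trans ((G t).norm_coe_le_norm (ξ, η)))
      simp only [ContinuousMap.smul_apply, smul_eq_mul, ← mul_add]
      rfl
  choose c hc hcv using hcurve
  have hne : ∀ t : ℝ, t ≠ 0 → Function.update c 0 ρ t = c t := fun t ht =>
    Function.update_of_ne ht _ _
  refine ⟨1, one_pos, Function.update c 0 ρ, fun t _ => ?_, Function.update_self _ _ _, ?_⟩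
  · by_cases ht : t = 0
    · rw [ht, Function.update_self]
      exact hρ
    · rw [hne t ht]
      exact hc t
  · have : Nonempty Z := ⟨z⟩
    rw [Metric.tendsto_nhds]
    intro e he
    filter_upwards [(eventually_exp_mul_le hA hv (half_pos he)).filter_mono nhdsWithin_le_nhds,
      self_mem_nhdsWithin] with t ht h0
    have h0 : t ≠ 0 := h0
    have htp : 0 < |t| := abs_pos.2 h0
    rw [hne t h0, Real.dist_0_eq_abs, abs_of_nonneg (Real.iSup_nonneg fun _ => abs_nonneg _)]
    have hnorm : Real.log ‖G t‖ ≤ e / 2 * |t| := by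
      rw [Real.log_le_iff_le_exp (hG1 t)]
      refine (ContinuousMap.norm_le _ (Real.exp_pos _).le).2 fun p => ?_
      change ‖Real.exp (t * (v p.1 + v p.2) / 2) * ρ p.1 p.2‖ ≤ _
      rw [Real.norm_of_nonneg (mul_nonneg (Real.exp_pos _).le (hA.toIsSeparating.nonneg _ _))]
      exact ht p.1 p.2
    refine lt_of_le_of_lt (ciSup_le fun ξ => ?_) (half_lt_self he)
    have : (1 / t) * Real.log (mDeriv ρ (c t) ξ) - v ξ
        = (Real.log (mDeriv ρ (c t) ξ) - t * v ξ) / t := by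
      field_simp
    rw [this, abs_div, div_le_iff₀ htp]
    exact (hcv t ξ).trans hnorm

/-- The odd functions as a submodule. -/
def oddSubmodule [TopologicalSpace Z] (ρ : Z → Z → ℝ) : Submodule ℝ C(Z, ℝ) where
  carrier := oddSet ρ
  add_mem' {v w} hv hw ξ η h := by
    simp only [ContinuousMap.add_apply]
    linarith [hv ξ η h, hw ξ η h]
  zero_mem' ξ η _ := by simp
  smul_mem' a v hv ξ η h := by
    simp only [ContinuousMap.smul_apply, smul_eq_mul]
    rw [← mul_add, hv ξ η h, mul_zero]

theorem isClosed_oddSet [TopologicalSpace Z] [CompactSpace Z] (ρ : Z → Z → ℝ) :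
    IsClosed (oddSet ρ) := by
  simp only [oddSet, Set.ofPred_forall]
  refine isClosed_iInter fun ξ => isClosed_iInter fun η => isClosed_iInter fun _ =>
    isClosed_eq ?_ continuous_const
  exact (continuous_eval_const ξ).add (continuous_eval_const η)

theorem statement19 [TopologicalSpace Z] [CompactSpace Z]
    [TopologicalSpace.MetrizableSpace Z] (h4 : HasFourPoints Z)
    (ρ₀ : Z → Z → ℝ) (h₀ : IsAntipodal ρ₀)
    (ρ : Z → Z → ℝ) (hρ : ρ ∈ MoebiusSpace ρ₀) :
    tangentSet ρ₀ ρ = oddSet ρ ∧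
    ∃ S : Submodule ℝ C(Z, ℝ), (S : Set (C(Z, ℝ))) = tangentSet ρ₀ ρ ∧
      IsClosed (S : Set (C(Z, ℝ))) := by
  have heq := (tangentSet_subset_oddSet ρ₀ ρ).antisymm (oddSet_subset_tangentSet h4 hρ)
  exact ⟨heq, oddSubmodule ρ, heq.symm, isClosed_oddSet ρ⟩
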